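/- Let n ≥ 8 be an even integer and let k be an even integer with 4 ≤ k ≤ n/2. Suppose a and b are odd integers with 1 ≤ a < b ≤ n−1 such that the accordion graph A[n,k] is isomorphic to the quartic circulant graph Ci[2n,{a,b}]. Then gcd(2n, a) = 1 and gcd(2n, b) = 1. -/

import Mathlib

open SimpleGraph

/-- The accordion graph `A[n,k]`: vertices `u_i = (false, i)` and `v_i = (true, i)`
for `i : ZMod n`, with edges `u_i u_{i+1}`, `v_i v_{i+1}`, `u_i v_i`, `u_i v_{i+k}`. -/
def accordion (n k : ℕ) : SimpleGraph (Bool × ZMod n) :=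
  SimpleGraph.fromRel (fun x y =>
    (x.1 = y.1 ∧ y.2 = x.2 + 1) ∨
    (x.1 = false ∧ y.1 = true ∧ (y.2 = x.2 ∨ y.2 = x.2 + (k : ZMod n))))

/-- The quartic circulant graph `Ci[m,{a,b}]` on the vertex set `ZMod m`, where `x_i` is
adjacent to `x_{i±a}` and `x_{i±b}`. -/
def Ci (m a b : ℕ) : SimpleGraph (ZMod m) :=
  SimpleGraph.circulantGraph ({(a : ZMod m), (b : ZMod m)} : Set (ZMod m))

/-- In an circulant graph, two consecutive edges `x y`, `y z` complete to a
parallelogram. -/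
lemma circulantGraph_adj_parallelogram {G : Type*} [AddCommGroup G] {s : Set G} {x y z : G}
    (hxy : (circulantGraph s).Adj x y) (hyz : (circulantGraph s).Adj y z) :
    (circulantGraph s).Adj x (x + z - y) ∧ (circulantGraph s).Adj z (x + z - y) := by
  have translate : ∀ {p q : G} (d : G), (circulantGraph s).Adj p q →
      (circulantGraph s).Adj (p + d) (q + d) := fun d h => circulantGraph_adj_translate.2 h
  refine ⟨?_, ?_⟩
  · convert translate (x - y) hyz using 1 <;> abel
  · convert translate (z - y) hxy.symm using 1 <;> abel

lemma accordion_adj_succ {n : ℕ} (k : ℕ) (hn : 1 < n) (i : ZMod n) :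
    (accordion n k).Adj (false, i) (false, i + 1) := by
  have : Fact (1 < n) := ⟨hn⟩
  simp [accordion, fromRel_adj]

/-- Two vertices at distance two along the `u`-cycle have only one common neighbour. -/
lemma accordion_commonNeighbor_unique {n k : ℕ} (hn : 8 ≤ n) (hk4 : 4 ≤ k) (hkn : 2 * k ≤ n)
    (i : ZMod n) (w : Bool × ZMod n) (h₁ : (accordion n k).Adj (false, i) w)
    (h₂ : (accordion n k).Adj (false, i + 1 + 1) w) : w = (false, i + 1) := by
  have cast_ne : ∀ m : ℕ, 0 < m → m < n → (m : ZMod n) ≠ 0 := fun m h0 hm h =>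
    Nat.not_dvd_of_pos_of_lt h0 hm ((ZMod.natCast_eq_zero_iff m n).1 h)
  have two_ne := cast_ne 2 (by omega) (by omega)
  have four_ne := cast_ne 4 (by omega) (by omega)
  have add_ne := cast_ne (k + 2) (by omega) (by omega)
  have sub_ne := cast_ne (k - 2) (by omega) (by omega)
  rw [Nat.cast_sub (by omega)] at sub_ne
  push_cast at two_ne four_ne add_ne sub_ne
  obtain ⟨c, j⟩ := w
  cases c <;> simp [accordion, fromRel_adj] at h₁ h₂ ⊢
  · grind
  · exfalso
    rcases h₁ with h₁ | h₁ <;> rcases h₂ with h₂ | h₂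
    · exact two_ne (by linear_combination h₁ - h₂)
    · exact add_ne (by linear_combination h₁ - h₂)
    · exact sub_ne (by linear_combination h₂ - h₁)
    · exact two_ne (by linear_combination h₁ - h₂)

/-- Let `n ≥ 8` be even and `k` even with `4 ≤ k ≤ n/2`. If `a` and `b` are odd with
`1 ≤ a < b ≤ n-1` and `A[n,k] ≅ Ci[2n,{a,b}]`, then `gcd(2n,a) = gcd(2n,b) = 1`. -/
theorem accordion_iso_circulant_gcd_one (n k a b : ℕ) (hn : 8 ≤ n) (hne : Even n)
    (hke : Even k) (hk4 : 4 ≤ k) (hkn : 2 * k ≤ n)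
    (hao : Odd a) (hbo : Odd b) (ha : 1 ≤ a) (hab : a < b) (hb : b ≤ n - 1)
    (hiso : Nonempty (accordion n k ≃g Ci (2 * n) a b)) :
    Nat.gcd (2 * n) a = 1 ∧ Nat.gcd (2 * n) b = 1 := by
  exfalso
  obtain ⟨f⟩ := hiso
  set g : ℕ → ZMod (2 * n) := fun i => f (false, (i : ZMod n)) with hg
  have adj_succ (i : ℕ) : (Ci (2 * n) a b).Adj (g i) (g (i + 1)) := by
    simpa [hg] using f.map_adj_iff.2 (accordion_adj_succ k (by omega) (i : ZMod n))
  have straight (i : ℕ) : g (i + 1 + 1) - g (i + 1) = g (i + 1) - g i := by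
    obtain ⟨h₁, h₂⟩ := circulantGraph_adj_parallelogram (adj_succ i) (adj_succ (i + 1))
    have end_eq : g (i + 1 + 1) = f (false, (i : ZMod n) + 1 + 1) := by simp [hg]
    have key := accordion_commonNeighbor_unique hn hk4 hkn (i : ZMod n)
      (f.symm (g i + g (i + 1 + 1) - g (i + 1)))
      (f.map_adj_iff.1 (by rw [f.apply_symm_apply]; exact h₁))
      (f.map_adj_iff.1 (by rw [f.apply_symm_apply, ← end_eq]; exact h₂))
    have fixed : g i + g (i + 1 + 1) - g (i + 1) = g (i + 1) := by
      rw [RelIso.symm_apply_eq] at key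
      rw [key]
      simp [hg]
    linear_combination fixed
  have step (i : ℕ) : g (i + 1) - g i = g 1 - g 0 := by
    induction i with
    | zero => rfl
    | succ i ih => rw [straight, ih]
  have linear (i : ℕ) : g i = g 0 + i * (g 1 - g 0) := by
    induction i with
    | zero => simp
    | succ i ih => push_cast; linear_combination step i + ih
  have closed : (n : ZMod (2 * n)) * (g 1 - g 0) = 0 := by
    have : g n = g 0 := by simp [hg]
    linear_combination this - linear n
  have odd_mul_ne (c : ℕ) (hc : Odd c) : (n : ZMod (2 * n)) * c ≠ 0 := by
    intro h
    rw [← Nat.cast_mul, ZMod.natCast_eq_zero_iff, mul_comm 2 n] at h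
    exact hc.not_two_dvd_nat (Nat.dvd_of_mul_dvd_mul_left (by omega) h)
  have adj := adj_succ 0
  simp only [Ci, circulantGraph_adj, Set.mem_insert_iff, Set.mem_singleton_iff, zero_add] at adj
  rcases adj with ⟨-, (h | h) | (h | h)⟩
  · exact odd_mul_ne a hao (by linear_combination -closed - n * h)
  · exact odd_mul_ne b hbo (by linear_combination -closed - n * h)
  · exact odd_mul_ne a hao (by linear_combination closed - n * h)
  · exact odd_mul_ne b hbo (by linear_combination closed - n * h)
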